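/- Ramsey theorem for decreasing sequences of increasing sequences: for all natural numbers a, b, r ≥ 1 and all permutations A : Equiv.Perm (Fin a) and B : Equiv.Perm (Fin b), each avoiding the patterns 213 and 132, there exist a natural number c and a permutation C : Equiv.Perm (Fin c) avoiding the patterns 213 and 132 such that for every coloring χ of the embeddings of A into C with r colors, there is an embedding g of B into C such that χ (g ∘ e) takes the same value for all embeddings e of A into B. -/

import Mathlib

/-- An embedding of the permutation `α` into the permutation `γ`. -/
def PermEmbedding {a c : ℕ} (α : Equiv.Perm (Fin a)) (γ : Equiv.Perm (Fin c))
    (f : Fin a → Fin c) : Prop :=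
  StrictMono f ∧ ∀ i j : Fin a, α i < α j ↔ γ (f i) < γ (f j)

/-- `σ` contains the pattern 213. -/
def ContainsPattern213 {n : ℕ} (σ : Equiv.Perm (Fin n)) : Prop :=
  ∃ i j k : Fin n, i < j ∧ j < k ∧ σ j < σ i ∧ σ i < σ k

/-- `σ` contains the pattern 132. -/
def ContainsPattern132 {n : ℕ} (σ : Equiv.Perm (Fin n)) : Prop :=
  ∃ i j k : Fin n, i < j ∧ j < k ∧ σ i < σ k ∧ σ k < σ j

open Filter in
/-- A function from `ℕ` to a finite type is constant along the hyperfilter. -/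
theorem exists_hyperfilter_eventually_eq {κ : Type*} [Finite κ] (f : ℕ → κ) :
    ∃ c, ∀ᶠ x in (hyperfilter ℕ : Filter ℕ), f x = c := by
  by_contra! h
  obtain ⟨x, hx⟩ := (eventually_all.2 h).exists
  exact hx (f x) rfl

open Filter in
/-- Finite subsets of `ℕ` of any size that are homogeneous for a colouring of finite sets. -/
theorem exists_homogeneous_finset {κ : Type*} [Finite κ] (k n : ℕ) (χ : Finset ℕ → κ) :
    ∃ H : Finset ℕ, H.card = n ∧ ∃ c, ∀ s ⊆ H, s.card = k → χ s = c := by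
  choose lim hlim using fun (ψ : Finset ℕ → κ) (s : Finset ℕ) =>
    exists_hyperfilter_eventually_eq fun x => ψ (insert x s)
  let Ψ : ℕ → Finset ℕ → κ := fun j => lim^[j] χ
  have hΨ (j : ℕ) (s : Finset ℕ) :
      ∀ᶠ x in (hyperfilter ℕ : Filter ℕ), Ψ j (insert x s) = Ψ (j + 1) s := by
    simp only [Ψ, Function.iterate_succ_apply']
    exact hlim _ s
  suffices ∃ H : Finset ℕ, H.card = n ∧
      ∀ s ⊆ H, ∀ j, s.card + j = k → Ψ j s = Ψ k ∅ by
    obtain ⟨H, hn, hH⟩ := this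
    exact ⟨H, hn, Ψ k ∅, fun s hs hk => hH s hs 0 hk⟩
  induction n with
  | zero =>
    refine ⟨∅, rfl, fun s hs j hj => ?_⟩
    obtain rfl := Finset.subset_empty.1 hs
    simp_all
  | succ n ih =>
    obtain ⟨H, hn, hH⟩ := ih
    have hstep : ∀ᶠ x in (hyperfilter ℕ : Filter ℕ),
        ∀ s ∈ H.powerset, ∀ j ∈ Finset.range k, Ψ j (insert x s) = Ψ (j + 1) s := by
      rw [Finset.eventually_all]
      intro s _
      rw [Finset.eventually_all]
      exact fun j _ => hΨ j s
    have hnew : ∀ᶠ x in (hyperfilter ℕ : Filter ℕ), x ∉ H :=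
      (hyperfilter_le_cofinite (α := ℕ)) H.finite_toSet.eventually_cofinite_notMem
    obtain ⟨x, hx, hxH⟩ := (hstep.and hnew).exists
    refine ⟨insert x H, by rw [Finset.card_insert_of_notMem hxH, hn], fun s hs j hj => ?_⟩
    by_cases hxs : x ∈ s
    · have hsub : s.erase x ⊆ H := by
        intro y hy
        have := hs (Finset.mem_of_mem_erase hy)
        simpa [Finset.ne_of_mem_erase hy] using this
      have hcard := Finset.card_erase_add_one hxs
      have := hx (s.erase x) (Finset.mem_powerset.2 hsub) j (Finset.mem_range.2 (by omega))
      rw [Finset.insert_erase hxs] at this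
      rw [this]
      exact hH _ hsub _ (by omega)
    · exact hH s ((Finset.subset_insert_iff_of_notMem hxs).1 hs) j hj

open Filter in
/-- The finite Ramsey theorem for colourings of `k`-element sets. -/
theorem finite_ramsey_finset {κ : Type*} [Finite κ] (k n : ℕ) :
    ∃ N : ℕ, ∀ χ : Finset ℕ → κ, ∃ H ⊆ Finset.range N, H.card = n ∧
      ∃ c, ∀ s ⊆ H, s.card = k → χ s = c := by
  by_contra! h
  choose χ hχ using h
  choose lim hlim using fun s : Finset ℕ => exists_hyperfilter_eventually_eq fun N => χ N s
  obtain ⟨H, hn, c, hc⟩ := exists_homogeneous_finset k n lim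
  have hagree : ∀ᶠ N in (hyperfilter ℕ : Filter ℕ), ∀ s ∈ H.powerset, χ N s = lim s := by
    rw [Finset.eventually_all]
    exact fun s _ => hlim s
  have hlarge : ∀ᶠ N in (hyperfilter ℕ : Filter ℕ), H.sup id < N :=
    Nat.hyperfilter_le_atTop (eventually_gt_atTop _)
  obtain ⟨N, hN, hHN⟩ := (hagree.and hlarge).exists
  obtain ⟨s, hs, hk, hne⟩ := hχ N H
    (fun x hx => Finset.mem_range.2 ((Finset.le_sup (f := id) hx).trans_lt hHN)) hn c
  exact hne ((hN s (Finset.mem_powerset.2 hs)).trans (hc s hs hk))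

/-- The finite Ramsey theorem for colourings of strictly increasing `k`-tuples. -/
theorem finite_ramsey {κ : Type*} [Finite κ] [Nonempty κ] (k n : ℕ) :
    ∃ N : ℕ, ∀ χ : (Fin k → Fin N) → κ, ∃ h : Fin n → Fin N, StrictMono h ∧
      ∃ c, ∀ e : Fin k → Fin n, StrictMono e → χ (h ∘ e) = c := by
  classical
  obtain ⟨N, hN⟩ := finite_ramsey_finset (κ := κ) k n
  refine ⟨N, fun χ => ?_⟩
  obtain ⟨H, hHN, hn, c, hc⟩ := hN fun s =>
    if hs : s.card = k ∧ s ⊆ Finset.range N then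
      χ fun i => ⟨s.orderEmbOfFin hs.1 i,
        Finset.mem_range.1 (hs.2 (s.orderEmbOfFin_mem hs.1 i))⟩
    else Classical.arbitrary κ
  refine ⟨fun i => ⟨H.orderEmbOfFin hn i,
    Finset.mem_range.1 (hHN (H.orderEmbOfFin_mem hn i))⟩,
    fun i j hij => (H.orderEmbOfFin hn).strictMono hij, c, fun e he => ?_⟩
  have hmono : StrictMono fun i => H.orderEmbOfFin hn (e i) :=
    (H.orderEmbOfFin hn).strictMono.comp he
  let s := Finset.univ.image fun i => H.orderEmbOfFin hn (e i)
  have hsH : s ⊆ H := by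
    intro x hx
    obtain ⟨i, -, rfl⟩ := Finset.mem_image.1 hx
    exact H.orderEmbOfFin_mem hn (e i)
  have hsk : s.card = k := by
    simp [s, Finset.card_image_of_injective _ hmono.injective]
  rw [← hc s hsH hsk, dif_pos ⟨hsk, hsH.trans hHN⟩]
  congr 1
  ext i
  exact congrFun (Finset.orderEmbOfFin_unique hsk
    (fun i => Finset.mem_image_of_mem _ (Finset.mem_univ i)) hmono) i

/-- The first element of the increasing block of `i`, when `σ` avoids 213 and 132. -/
def blockStart {n : ℕ} (σ : Equiv.Perm (Fin n)) (i : Fin n) : Fin n :=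
  (Finset.univ.filter fun j => j ≤ i ∧ σ j ≤ σ i).min' ⟨i, by simp⟩

section BlockStart

variable {n : ℕ} {σ : Equiv.Perm (Fin n)} {i j : Fin n}

theorem blockStart_spec (σ : Equiv.Perm (Fin n)) (i : Fin n) :
    blockStart σ i ≤ i ∧ σ (blockStart σ i) ≤ σ i :=
  (Finset.mem_filter.1
    (Finset.min'_mem (Finset.univ.filter fun j => j ≤ i ∧ σ j ≤ σ i) ⟨i, by simp⟩)).2

theorem blockStart_le_self (σ : Equiv.Perm (Fin n)) (i : Fin n) : blockStart σ i ≤ i :=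
  (blockStart_spec σ i).1

theorem blockStart_le (hij : j ≤ i) (hσ : σ j ≤ σ i) : blockStart σ i ≤ j :=
  Finset.min'_le _ _ (by simp [hij, hσ])

theorem blockStart_eq_of_lt (h213 : ¬ ContainsPattern213 σ) (hij : i < j) (hσ : σ i < σ j) :
    blockStart σ i = blockStart σ j := by
  obtain ⟨hi, hσi⟩ := blockStart_spec σ i
  obtain ⟨-, hσj⟩ := blockStart_spec σ j
  have hle := blockStart_le (hi.trans hij.le) (hσi.trans hσ.le)
  refine le_antisymm (blockStart_le (hle.trans hi) ?_) hle
  by_contra! hlt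
  have hlt_i : blockStart σ j < i := (hle.trans hi).lt_of_ne (by rintro h; simp [h] at hlt)
  refine h213 ⟨_, i, j, hlt_i, hij, hlt, hσj.lt_of_ne fun h => ?_⟩
  exact (hlt_i.trans hij).ne (σ.injective h)

theorem lt_blockStart (h132 : ¬ ContainsPattern132 σ) (hij : i < j) (hσ : σ j < σ i) :
    i < blockStart σ j := by
  obtain ⟨-, hσj⟩ := blockStart_spec σ j
  by_contra! hle
  have hlt_i : blockStart σ j < i :=
    hle.lt_of_ne (by rintro h; rw [h] at hσj; exact hσj.not_gt hσ)
  refine h132 ⟨_, i, j, hlt_i, hij, hσj.lt_of_ne fun h => ?_, hσ⟩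
  exact (hlt_i.trans hij).ne (σ.injective h)

theorem blockStart_blockStart (h213 : ¬ ContainsPattern213 σ) (i : Fin n) :
    blockStart σ (blockStart σ i) = blockStart σ i := by
  obtain ⟨hi, hσi⟩ := blockStart_spec σ i
  rcases hi.eq_or_lt with h | h
  · rw [h, h]
  · exact blockStart_eq_of_lt h213 h (hσi.lt_of_ne (σ.injective.ne h.ne))

end BlockStart

/-- The decreasing sequence of `N` increasing sequences of length `N`. -/
def gridPerm (N : ℕ) : Equiv.Perm (Fin (N * N)) :=
  finProdFinEquiv.symm.trans ((Fin.revPerm.prodCongr (Equiv.refl _)).trans finProdFinEquiv)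

section GridPerm

variable {N : ℕ}

theorem finProdFinEquiv_lt_iff {m n : ℕ} {p q : Fin m × Fin n} :
    finProdFinEquiv p < finProdFinEquiv q ↔ p.1 < q.1 ∨ p.1 = q.1 ∧ p.2 < q.2 := by
  obtain ⟨x, y⟩ := p
  obtain ⟨x', y'⟩ := q
  simp only [Fin.lt_def, Fin.ext_iff, finProdFinEquiv_apply_val]
  have hy := y.2
  have hy' := y'.2
  rcases lt_trichotomy (x : ℕ) x' with h | h | h
  · have := Nat.mul_le_mul_left n (Nat.succ_le_of_lt h)
    rw [Nat.mul_succ] at this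
    omega
  · rw [h]; omega
  · have := Nat.mul_le_mul_left n (Nat.succ_le_of_lt h)
    rw [Nat.mul_succ] at this
    omega

theorem gridPerm_lt_iff {p q : Fin N × Fin N} :
    gridPerm N (finProdFinEquiv p) < gridPerm N (finProdFinEquiv q) ↔
      q.1 < p.1 ∨ p.1 = q.1 ∧ p.2 < q.2 := by
  simp [gridPerm, finProdFinEquiv_lt_iff]

theorem gridPerm_avoids_213 (N : ℕ) : ¬ ContainsPattern213 (gridPerm N) := by
  rintro ⟨i, j, k, hij, hjk, h₁, h₂⟩
  obtain ⟨p, rfl⟩ := finProdFinEquiv.surjective i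
  obtain ⟨q, rfl⟩ := finProdFinEquiv.surjective j
  obtain ⟨s, rfl⟩ := finProdFinEquiv.surjective k
  rw [finProdFinEquiv_lt_iff] at hij hjk
  rw [gridPerm_lt_iff] at h₁ h₂
  omega

theorem gridPerm_avoids_132 (N : ℕ) : ¬ ContainsPattern132 (gridPerm N) := by
  rintro ⟨i, j, k, hij, hjk, h₁, h₂⟩
  obtain ⟨p, rfl⟩ := finProdFinEquiv.surjective i
  obtain ⟨q, rfl⟩ := finProdFinEquiv.surjective j
  obtain ⟨s, rfl⟩ := finProdFinEquiv.surjective k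
  rw [finProdFinEquiv_lt_iff] at hij hjk
  rw [gridPerm_lt_iff] at h₁ h₂
  omega

end GridPerm

/-- A `2 * n`-tuple in `Fin N` places a permutation of size `n` in the grid: even entries at block
starts give the blocks, odd entries the positions inside the blocks. -/
def gridMap {n N : ℕ} (σ : Equiv.Perm (Fin n)) (h : Fin (2 * n) → Fin N) (i : Fin n) :
    Fin (N * N) :=
  finProdFinEquiv (h ⟨2 * blockStart σ i, by omega⟩, h ⟨2 * i + 1, by omega⟩)

theorem permEmbedding_gridMap {n N : ℕ} {σ : Equiv.Perm (Fin n)} {h : Fin (2 * n) → Fin N}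
    (h213 : ¬ ContainsPattern213 σ) (h132 : ¬ ContainsPattern132 σ) (hh : StrictMono h) :
    PermEmbedding σ (gridPerm N) (gridMap σ h) := by
  have key (i j : Fin n) (hij : i < j) : gridMap σ h i < gridMap σ h j ∧
      (σ i < σ j ↔ gridPerm N (gridMap σ h i) < gridPerm N (gridMap σ h j)) := by
    have hpos : h ⟨2 * i + 1, by omega⟩ < h ⟨2 * j + 1, by omega⟩ := hh (by simpa using hij)
    unfold gridMap
    rw [finProdFinEquiv_lt_iff, gridPerm_lt_iff]
    rcases lt_or_gt_of_ne (σ.injective.ne hij.ne) with hσ | hσ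
    · simp [blockStart_eq_of_lt h213 hij hσ, hpos, hσ]
    · have hlt : h ⟨2 * blockStart σ i, by omega⟩ < h ⟨2 * blockStart σ j, by omega⟩ :=
        hh (by simpa using (blockStart_le_self σ i).trans_lt (lt_blockStart h132 hij hσ))
      simp [hlt, hlt.ne, hlt.not_gt, hσ.not_gt]
  refine ⟨fun i j hij => (key i j hij).1, fun i j => ?_⟩
  rcases lt_trichotomy i j with hij | rfl | hij
  · exact (key i j hij).2
  · simp
  · have hne := (gridPerm N).injective.ne (key j i hij).1.ne
    have := (key j i hij).2
    have hσ := σ.injective.ne hij.ne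
    omega

/-- An embedding of permutations acts on the tuples that describe placements in the grid. -/
theorem exists_gridMap_comp {a b : ℕ} {A : Equiv.Perm (Fin a)} {B : Equiv.Perm (Fin b)}
    (hA213 : ¬ ContainsPattern213 A) (hB213 : ¬ ContainsPattern213 B)
    (hB132 : ¬ ContainsPattern132 B) {e : Fin a → Fin b} (he : PermEmbedding A B e) :
    ∃ e' : Fin (2 * a) → Fin (2 * b), StrictMono e' ∧
      ∀ {N : ℕ} (h : Fin (2 * b) → Fin N), gridMap B h ∘ e = gridMap A (h ∘ e') := by
  obtain ⟨hmono, hiff⟩ := he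
  let lower : Fin a → Fin b := fun i => if blockStart A i = i then blockStart B (e i) else e i
  have hlower_le (i : Fin a) : lower i ≤ e i := by
    unfold lower
    split_ifs
    exacts [blockStart_le_self B _, le_rfl]
  have hlt_lower {i j : Fin a} (hij : i < j) : e i < lower j := by
    unfold lower
    split_ifs with hj
    · refine lt_blockStart hB132 (hmono hij) ?_
      refine lt_of_le_of_ne ?_ (B.injective.ne (hmono hij).ne')
      by_contra! hlt
      have heq := blockStart_eq_of_lt hA213 hij ((hiff i j).2 hlt)
      exact ((blockStart_le_self A i).trans_lt hij).ne (heq.trans hj)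
    · exact hmono hij
  let half : Fin (2 * a) → Fin a := fun u => ⟨u / 2, by omega⟩
  refine ⟨fun u => if (u : ℕ) % 2 = 0 then ⟨2 * lower (half u), by omega⟩
    else ⟨2 * e (half u) + 1, by omega⟩, fun u v huv => ?_, fun {N} h => ?_⟩
  · rcases (show half u ≤ half v from Nat.div_le_div_right huv.le).eq_or_lt with heq | hlt
    · have hval : (u : ℕ) / 2 = v / 2 := congrArg Fin.val heq
      have hu : (u : ℕ) % 2 = 0 := by omega
      have hv : (v : ℕ) % 2 ≠ 0 := by omega
      have := hlower_le (half v)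
      simp only [hu, hv, heq, if_true, if_false, Fin.lt_def]
      omega
    · have h₁ := hlower_le (half u)
      have h₂ := hlower_le (half v)
      have h₃ := hlt_lower hlt
      dsimp only
      split_ifs <;> simp only [Fin.lt_def] <;> omega
  · funext i
    have hstart : lower (blockStart A i) = blockStart B (e i) := by
      unfold lower
      rw [if_pos (blockStart_blockStart hA213 i)]
      obtain ⟨hi, hAi⟩ := blockStart_spec A i
      rcases hi.eq_or_lt with heq | hlt
      · rw [heq]
      · exact blockStart_eq_of_lt hB213 (hmono hlt)
          ((hiff _ _).1 (hAi.lt_of_ne (A.injective.ne hlt.ne)))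
    have heven : half ⟨2 * blockStart A i, by omega⟩ = blockStart A i := by
      ext; simp [half]
    have hodd : half ⟨2 * i + 1, by omega⟩ = i := by
      ext; simp only [half]; omega
    simp [gridMap, heven, hodd, hstart, Nat.add_mod]

/-- Ramsey theorem for decreasing sequences of increasing sequences,
i.e. permutations avoiding the patterns 213 and 132. -/
theorem ramsey_decreasing_of_increasing (a b r : ℕ) (ha : 1 ≤ a) (hb : 1 ≤ b) (hr : 1 ≤ r)
    (A : Equiv.Perm (Fin a)) (B : Equiv.Perm (Fin b))
    (hA213 : ¬ ContainsPattern213 A) (hA132 : ¬ ContainsPattern132 A)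
    (hB213 : ¬ ContainsPattern213 B) (hB132 : ¬ ContainsPattern132 B) :
    ∃ (c : ℕ) (C : Equiv.Perm (Fin c)),
      ¬ ContainsPattern213 C ∧ ¬ ContainsPattern132 C ∧
      ∀ χ : (Fin a → Fin c) → Fin r,
        ∃ g : Fin b → Fin c, PermEmbedding B C g ∧
          ∃ k : Fin r, ∀ e : Fin a → Fin b, PermEmbedding A B e → χ (g ∘ e) = k := by
  have : Nonempty (Fin r) := ⟨⟨0, hr⟩⟩
  obtain ⟨N, hN⟩ := finite_ramsey (κ := Fin r) (2 * a) (2 * b)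
  refine ⟨N * N, gridPerm N, gridPerm_avoids_213 N, gridPerm_avoids_132 N, fun χ => ?_⟩
  obtain ⟨h, hh, k, hk⟩ := hN fun f => χ (gridMap A f)
  refine ⟨gridMap B h, permEmbedding_gridMap hB213 hB132 hh, k, fun e he => ?_⟩
  obtain ⟨e', he', hcomp⟩ := exists_gridMap_comp hA213 hB213 hB132 he
  rw [hcomp h]
  exact hk e' he'
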